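/- arXiv:1108.5751 — 3 statements merged into one kernel-verified Lean document; each statement's English description precedes it below -/
import Mathlib

section
/- Let 𝒜 be an epireflective class of topological spaces in which every member is a Hausdorff space and which contains a space with at least two points, and let ℬ be a hereditary AD-class in 𝒜. Then ℬ is closed under prime factors: X_a ∈ ℬ for every X ∈ ℬ and every a ∈ X. -/
open Topology

universe u v w

/-- A class of topological spaces (underlying types in a fixed universe). -/
def SpaceClass : Type (u + 1) :=
  ∀ (X : Type u), TopologicalSpace X → Prop

/-- Closedness under homeomorphic copies. -/
def ClosedUnderHomeo (ℬ : SpaceClass.{u}) : Prop :=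
  ∀ (X Y : Type u) (tX : TopologicalSpace X) (tY : TopologicalSpace Y),
    Nonempty (@Homeomorph X Y tX tY) → ℬ X tX → ℬ Y tY

/-- An epireflective class: closed under homeomorphic copies, subspaces and
set-indexed topological products. -/
structure IsEpireflectiveClass (𝒜 : SpaceClass.{u}) : Prop where
  homeo : ClosedUnderHomeo 𝒜
  subspace : ∀ (X : Type u) (tX : TopologicalSpace X) (s : Set X),
    𝒜 X tX → 𝒜 s (TopologicalSpace.induced (Subtype.val : s → X) tX)
  prod : ∀ (ι : Type u) (Y : ι → Type u) (t : ∀ i, TopologicalSpace (Y i)),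
    (∀ i, 𝒜 (Y i) (t i)) → 𝒜 (∀ i, Y i) (@Pi.topologicalSpace ι Y t)

/-- The disjoint-union (topological sum) topology on a sigma type. -/
def sigmaTop {ι : Type v} (Y : ι → Type w) (t : ∀ i, TopologicalSpace (Y i)) :
    TopologicalSpace (Σ i, Y i) :=
  ⨆ i, TopologicalSpace.coinduced (Sigma.mk i) (t i)

/-- An AD-class in `𝒜`: a subclass of `𝒜` closed under homeomorphic copies, closed
under topological sums of arbitrary families of its members, and divisible in `𝒜`
(quotients in `𝒜` of members of `ℬ` belong to `ℬ`). -/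
structure IsADClass (𝒜 ℬ : SpaceClass.{u}) : Prop where
  subset : ∀ (X : Type u) (tX : TopologicalSpace X), ℬ X tX → 𝒜 X tX
  homeo : ClosedUnderHomeo ℬ
  sums : ∀ (ι : Type u) (Y : ι → Type u) (t : ∀ i, TopologicalSpace (Y i)),
    (∀ i, ℬ (Y i) (t i)) → ℬ (Σ i, Y i) (sigmaTop Y t)
  divisible : ∀ (X Z : Type u) (tX : TopologicalSpace X) (tZ : TopologicalSpace Z)
    (q : X → Z), ℬ X tX → 𝒜 Z tZ → @IsQuotientMap X Z tX tZ q → ℬ Z tZ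

/-- A class is hereditary if every nonempty subspace of each member belongs to it. -/
def IsHereditary (ℬ : SpaceClass.{u}) : Prop :=
  ∀ (X : Type u) (tX : TopologicalSpace X) (s : Set X), s.Nonempty → ℬ X tX →
    ℬ s (TopologicalSpace.induced (Subtype.val : s → X) tX)

/-- The prime factor `X_a`: the topology on the underlying set of `X` whose open sets
are exactly the sets `U` such that `a ∈ U` implies `U` is a neighbourhood of `a`. -/
def primeFactor {X : Type u} (t : TopologicalSpace X) (a : X) : TopologicalSpace X where
  IsOpen U := a ∈ U → U ∈ @nhds X t a
  isOpen_univ := fun _ => Filter.univ_mem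
  isOpen_inter := fun U V hU hV h => Filter.inter_mem (hU h.1) (hV h.2)
  isOpen_sUnion := fun S hS h => by
    obtain ⟨U, hU, haU⟩ := h
    exact Filter.mem_of_superset (hS U hU haU) (Set.subset_sUnion_of_mem hU)

/-- A prime space: a topological space with exactly one non-isolated point. -/
def IsPrimeSpace (X : Type u) (t : TopologicalSpace X) : Prop :=
  ∃! a : X, ¬ @IsOpen X t {a}


section Helpers

theorem aux_quot {X Y : Type u} [tX : TopologicalSpace X] [tY : TopologicalSpace Y] {f : X → Y} :
    IsQuotientMap f ↔ Function.Surjective f ∧ ∀ s : Set Y, IsOpen s ↔ IsOpen (f ⁻¹' s) := by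
  constructor
  · intro h
    refine ⟨h.surjective, fun s => ?_⟩
    exact h.isOpen_preimage.symm
  · rintro ⟨h1, h2⟩
    refine ⟨⟨?_⟩, h1⟩
    ext s
    exact h2 s

theorem aux_embed {𝒜 : SpaceClass.{u}} (hA : IsEpireflectiveClass 𝒜)
    {Z Y : Type u} [tZ : TopologicalSpace Z] [tY : TopologicalSpace Y]
    (hY : 𝒜 Y tY) (f : Z → Y) (hf : IsEmbedding f) : 𝒜 Z tZ :=
  hA.homeo (Set.range f) Z _ _ ⟨hf.toHomeomorph.symm⟩ (hA.subspace Y tY (Set.range f) hY)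

theorem aux_mem {𝒜 : SpaceClass.{u}} (hA : IsEpireflectiveClass 𝒜)
    {Z Y : Type u} [tZ : TopologicalSpace Z] [tY : TopologicalSpace Y] [T1Space Z]
    [T1Space Y] (hY : 𝒜 Y tY) {y0 y1 : Y} (hy : y0 ≠ y1) (r : Z → Y) (hr : Continuous r)
    (h : ∀ (U : Set Z) (z : Z), IsOpen U → z ∈ U → ∃ C : Set Z, IsClopen C ∧ z ∈ C ∧
      ∃ V : Set Y, IsOpen V ∧ r z ∈ V ∧ ∀ w, r w ∈ V → w ∈ C → w ∈ U) : 𝒜 Z tZ := by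
  classical
  let ι := Option {C : Set Z // IsClopen C}
  let f : ι → Z → Y := fun i => match i with
    | none => r
    | some C => fun z => if z ∈ C.1 then y0 else y1
  have hfc : ∀ i, Continuous (f i) := by
    rintro (_ | ⟨C, hC⟩)
    · exact hr
    · have : IsLocallyConstant (fun z => if z ∈ C then y0 else y1) := by
        rw [IsLocallyConstant.iff_exists_open]
        intro x
        by_cases hx : x ∈ C
        · exact ⟨C, hC.isOpen, hx, fun w hw => by simp [hx, hw]⟩
        · exact ⟨Cᶜ, hC.compl.isOpen, hx, fun w hw => by
            have : w ∉ C := hw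
            simp [hx, this]⟩
      exact this.continuous
  let F : Z → (ι → Y) := fun z i => f i z
  have hF : Continuous F := continuous_pi hfc
  have hind : IsInducing F := by
    rw [isInducing_iff_nhds]
    intro z
    apply le_antisymm
    · exact hF.continuousAt.tendsto.le_comap
    · intro U hU
      obtain ⟨U', hU'U, hU', hz⟩ := mem_nhds_iff.1 hU
      obtain ⟨C, hC, hzC, V, hV, hzV, hw⟩ := h U' z hU' hz
      refine ⟨{g | g none ∈ V ∧ g (some ⟨C, hC⟩) ∈ ({y1} : Set Y)ᶜ}, ?_, ?_⟩
      · apply IsOpen.mem_nhds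
        · exact (hV.preimage (continuous_apply _)).inter
            (isOpen_compl_singleton.preimage (continuous_apply _))
        · refine ⟨hzV, ?_⟩
          simp [F, f, hzC, hy]
      · rintro w ⟨h1, h2⟩
        apply hU'U
        apply hw w h1
        by_contra hwC
        apply h2
        simp [F, f, hwC]
  exact aux_embed hA (hA.prod ι (fun _ => Y) (fun _ => tY) (fun _ => hY)) F hind.isEmbedding

theorem aux_closed {P : Type u} [TopologicalSpace P] {p : P}
    (hp : ∀ y, y ≠ p → IsOpen {y}) {U : Set P} (h : p ∉ U) : IsOpen U := by
  have : U = ⋃ y ∈ U, {y} := by simp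
  rw [this]
  refine isOpen_biUnion fun y hy => hp y ?_
  rintro rfl
  exact h hy

theorem aux_prime {𝒜 : SpaceClass.{u}} (hA : IsEpireflectiveClass 𝒜)
    (hT2 : ∀ (X : Type u) (tX : TopologicalSpace X), 𝒜 X tX → @T2Space X tX)
    (hA2 : ∃ (X : Type u) (tX : TopologicalSpace X), 𝒜 X tX ∧ ∃ x y : X, x ≠ y)
    {P : Type u} [tP : TopologicalSpace P] [T1Space P] (p : P)
    (hp : ∀ y, y ≠ p → IsOpen {y}) : 𝒜 P tP := by
  obtain ⟨Y, tY, hY, y0, y1, hy⟩ := hA2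
  haveI := hT2 Y tY hY
  refine aux_mem hA hY hy (fun _ => y0) continuous_const ?_
  intro U z hU hz
  by_cases hzp : z = p
  · subst hzp
    exact ⟨U, ⟨⟨aux_closed hp (by simpa using hz)⟩, hU⟩, hz, Set.univ, isOpen_univ, trivial,
      fun w _ h => h⟩
  · refine ⟨{z}, ⟨isClosed_singleton, hp z hzp⟩, rfl, Set.univ, isOpen_univ, trivial, ?_⟩
    rintro w _ rfl
    exact hz

theorem aux_exists_prime {𝒜 ℬ : SpaceClass.{u}} (hA : IsEpireflectiveClass 𝒜)
    (hT2 : ∀ (X : Type u) (tX : TopologicalSpace X), 𝒜 X tX → @T2Space X tX)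
    (hA2 : ∃ (X : Type u) (tX : TopologicalSpace X), 𝒜 X tX ∧ ∃ x y : X, x ≠ y)
    (hB : IsADClass 𝒜 ℬ) (hher : IsHereditary ℬ)
    (X : Type u) [tX : TopologicalSpace X] (hX : ℬ X tX) (a : X) (ha : ¬ IsOpen {a}) :
    ∃ (P : Type u) (tP : TopologicalSpace P) (p : P), ℬ P tP ∧ T1Space P ∧
      (∀ y, y ≠ p → IsOpen {y}) ∧ ¬ IsOpen {p} := by
  classical
  haveI := hT2 X tX (hB.subset _ _ hX)
  obtain ⟨S, hS⟩ := zorn_subset {S : Set (Set X) | S.PairwiseDisjoint id ∧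
      ∀ U ∈ S, IsOpen U ∧ U.Nonempty ∧ a ∉ closure U} (by
    intro c hc hch
    refine ⟨⋃₀ c, ⟨?_, ?_⟩, fun s hs => Set.subset_sUnion_of_mem hs⟩
    · exact (Set.pairwiseDisjoint_sUnion hch.directedOn).2 fun s hs => (hc hs).1
    · rintro U ⟨s, hs, hU⟩
      exact (hc hs).2 U hU)
  obtain ⟨⟨hdis, hSU⟩, hmax⟩ := hS
  have haU : ∀ U ∈ S, a ∉ U := fun U hU h => (hSU U hU).2.2 (subset_closure h)
  let D : Set X := {a} ∪ ⋃₀ S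
  have hD : ℬ D _ := hher X tX D ⟨a, Or.inl rfl⟩ hX
  let f : D → Option S := fun x =>
    if h : ∃ U : S, x.1 ∈ U.1 then some h.choose else none
  have hf1 : ∀ (x : D) (U : S), f x = some U ↔ x.1 ∈ U.1 := by
    intro x U
    constructor
    · intro h
      by_cases hx : ∃ U : S, x.1 ∈ U.1
      · simp only [f, hx, dif_pos] at h
        have := hx.choose_spec
        rw [Option.some.inj h] at this
        exact this
      · have h0 : f x = none := dif_neg hx
        rw [h0] at h
        cases h
    · intro h
      have hx : ∃ U : S, x.1 ∈ U.1 := ⟨U, h⟩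
      simp only [f, hx, dif_pos]
      congr 1
      have := hx.choose_spec
      by_contra hne
      have hd := hdis hx.choose.2 U.2 (fun e => hne (Subtype.ext e))
      exact Set.disjoint_left.1 hd this h
  have hf2 : ∀ (x : D), f x = none ↔ x.1 = a := by
    intro x
    constructor
    · intro h
      rcases x.2 with h' | ⟨U, hU, hxU⟩
      · exact h'
      · have := (hf1 x ⟨U, hU⟩).2 hxU
        rw [h] at this
        cases this
    · intro h
      cases hx : f x with
      | none => rfl
      | some U =>
        have := (hf1 x U).1 hx
        rw [h] at this
        exact absurd this (haU U.1 U.2)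
  letI tP : TopologicalSpace (Option S) := TopologicalSpace.coinduced f inferInstance
  have hfo : ∀ s : Set (Option S), IsOpen s ↔ IsOpen (f ⁻¹' s) := fun s => isOpen_coinduced
  have hpt : ∀ y : Option S, y ≠ none → IsOpen {y} := by
    rintro (_ | U) hy
    · exact absurd rfl hy
    · rw [hfo]
      have : f ⁻¹' {some U} = Subtype.val ⁻¹' U.1 := by
        ext x
        exact hf1 x U
      rw [this]
      exact (hSU U.1 U.2).1.preimage continuous_subtype_val
  haveI hT1 : T1Space (Option S) := by
    refine ⟨?_⟩
    rintro (_ | U)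
    · exact ⟨aux_closed hpt (by simp)⟩
    · refine ⟨?_⟩
      rw [hfo]
      have : f ⁻¹' {some U}ᶜ = Subtype.val ⁻¹' ((closure U.1)ᶜ ∪ ⋃₀ (S \ {U.1})) := by
        ext x
        have h1 : x ∈ f ⁻¹' {some U}ᶜ ↔ x.1 ∉ U.1 := not_congr (hf1 x U)
        rw [h1]
        constructor
        · intro hx
          rcases x.2 with h' | ⟨V, hV, hxV⟩
          · left
            rw [h']
            exact (hSU U.1 U.2).2.2
          · right
            refine ⟨V, ⟨hV, ?_⟩, hxV⟩
            rintro rfl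
            exact hx hxV
        · rintro (h | ⟨V, ⟨hV, hne⟩, hxV⟩) hxU
          · exact h (subset_closure hxU)
          · exact Set.disjoint_left.1 (hdis hV U.2 hne) hxV hxU
      rw [this]
      apply IsOpen.preimage continuous_subtype_val
      exact isClosed_closure.isOpen_compl.union
        (isOpen_sUnion fun V hV => (hSU V hV.1).1)
  refine ⟨Option S, tP, none, ?_, hT1, hpt, ?_⟩
  · refine hB.divisible D (Option S) _ tP f hD (aux_prime hA hT2 hA2 none hpt) ?_
    refine ⟨⟨rfl⟩, ?_⟩
    rintro (_ | U)
    · exact ⟨⟨a, Or.inl rfl⟩, (hf2 _).2 rfl⟩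
    · obtain ⟨x, hx⟩ := (hSU U.1 U.2).2.1
      exact ⟨⟨x, Or.inr ⟨U.1, U.2, hx⟩⟩, (hf1 _ _).2 hx⟩
  · intro hno
    rw [hfo] at hno
    obtain ⟨W, hW, hWf⟩ := isOpen_induced_iff.1 hno
    have haW : a ∈ W := by
      have : (⟨a, Or.inl rfl⟩ : D) ∈ f ⁻¹' {none} := (hf2 _).2 rfl
      rw [← hWf] at this
      exact this
    have hWS : ∀ U ∈ S, ∀ x ∈ U, x ∉ W := by
      intro U hU x hx hxW
      have : (⟨x, Or.inr ⟨U, hU, hx⟩⟩ : D) ∈ Subtype.val ⁻¹' W := hxW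
      rw [hWf] at this
      have := (hf2 _).1 this
      simp only at this
      subst this
      exact haU U hU hx
    have : ∃ x ∈ W, x ≠ a := by
      by_contra! hc
      apply ha
      have : W = {a} := by
        ext x
        exact ⟨fun h => hc x h, fun h => by rw [h]; exact haW⟩
      rwa [← this]
    obtain ⟨x, hxW, hxa⟩ := this
    obtain ⟨O, O', hO, hO', hxO, haO', hdisj⟩ := t2_separation hxa
    have hnew : O ∩ W ∈ S := by
      refine hmax (y := insert (O ∩ W) S) ⟨?_, ?_⟩ (Set.subset_insert _ _)
        (Set.mem_insert _ _)
      · refine hdis.insert fun V hV _ => ?_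
        exact Set.disjoint_left.2 fun z hz hzV => hWS V hV z hzV hz.2
      · rintro V (rfl | hV)
        · refine ⟨hO.inter hW, ⟨x, hxO, hxW⟩, fun h => ?_⟩
          obtain ⟨z, hz1, hz2⟩ := mem_closure_iff.1 h O' hO' haO'
          exact Set.disjoint_left.1 hdisj hz2.1 hz1
        · exact hSU V hV
    exact hWS _ hnew x ⟨hxO, hxW⟩ hxW

/-- `X` with a copy of `P` attached at every point, as a set `X × P`. -/
def glueTop (X P : Type u) [TopologicalSpace X] [TopologicalSpace P] (p : P) :
    TopologicalSpace (X × P) where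
  IsOpen U := IsOpen {x | (x, p) ∈ U} ∧ ∀ x, IsOpen {y | (x, y) ∈ U}
  isOpen_univ := by simp
  isOpen_inter := fun U V hU hV => ⟨hU.1.inter hV.1, fun x => (hU.2 x).inter (hV.2 x)⟩
  isOpen_sUnion := fun S hS => by
    constructor
    · have : {x | (x, p) ∈ ⋃₀ S} = ⋃ U ∈ S, {x | (x, p) ∈ U} := by
        ext; simp
      rw [this]
      exact isOpen_biUnion fun U hU => (hS U hU).1
    · intro x
      have : {y | (x, y) ∈ ⋃₀ S} = ⋃ U ∈ S, {y | (x, y) ∈ U} := by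
        ext; simp
      rw [this]
      exact isOpen_biUnion fun U hU => (hS U hU).2 x

def glueFam (X P : Type u) : Option X → Type u
  | none => X
  | some _ => P

def glueFamTop (X P : Type u) (tX : TopologicalSpace X) (tP : TopologicalSpace P) :
    ∀ o : Option X, TopologicalSpace (glueFam X P o)
  | none => tX
  | some _ => tP

def glueMap (X P : Type u) (p : P) : (Σ o, glueFam X P o) → X × P
  | ⟨none, x⟩ => ((show X from x), p)
  | ⟨some x, y⟩ => (x, (show P from y))

theorem aux_glue {𝒜 ℬ : SpaceClass.{u}} (hA : IsEpireflectiveClass 𝒜)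
    (hB : IsADClass 𝒜 ℬ)
    {X P : Type u} [tX : TopologicalSpace X] [tP : TopologicalSpace P] [T1Space X] [T1Space P]
    (p : P) (hX : ℬ X tX) (hP : ℬ P tP) (hp : ∀ y, y ≠ p → IsOpen {y})
    {x0 x1 : X} (hx : x0 ≠ x1) : ℬ (X × P) (glueTop X P p) := by
  classical
  have hsum := hB.sums (Option X) (glueFam X P) (glueFamTop X P tX tP) (by
    rintro (_ | x)
    · exact hX
    · exact hP)
  refine hB.divisible _ _ _ (glueTop X P p) (glueMap X P p) hsum ?_ ?_
  · letI tG := glueTop X P p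
    have ho : ∀ U : Set (X × P), IsOpen[tG] U ↔
      (IsOpen {x | (x, p) ∈ U} ∧ ∀ x, IsOpen {y | (x, y) ∈ U}) := fun U => Iff.rfl
    haveI : @T1Space (X × P) tG := by
      refine @T1Space.mk _ tG ?_
      rintro ⟨x, y⟩
      refine @IsClosed.mk _ tG _ ?_
      rw [ho]
      constructor
      · by_cases hy : p = y
        · have : {x' | (x', p) ∈ ({(x, y)} : Set (X × P))ᶜ} = {x}ᶜ := by
            ext; simp [hy]
          rw [this]
          exact isOpen_compl_singleton
        · simp [hy]
      · intro x'
        by_cases hy : x' = x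
        · have : {y' | (x', y') ∈ ({(x, y)} : Set (X × P))ᶜ} = {y}ᶜ := by
            ext; simp [hy]
          rw [this]
          exact isOpen_compl_singleton
        · simp [hy]
    refine @aux_mem 𝒜 hA (X × P) X tG tX _ _ (hB.subset _ _ hX) x0 x1 hx Prod.fst ?_ ?_
    · refine (@continuous_def _ _ tG tX _).2 fun V hV => ?_
      rw [ho]
      exact ⟨hV, fun x => isOpen_const (p := x ∈ V)⟩
    · rintro U ⟨x, y⟩ hU hz
      rw [ho] at hU
      by_cases hy : y = p
      · subst hy
        refine ⟨{g | (g.1, y) ∈ U → g ∈ U}, ⟨?_, ?_⟩, fun _ => hz,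
          {x | (x, y) ∈ U}, hU.1, hz, fun w h1 h2 => h2 h1⟩
        · refine @IsClosed.mk _ tG _ ?_
          rw [ho]
          constructor
          · simp
          · intro x'
            exact aux_closed hp (by simp)
        · rw [ho]
          constructor
          · simp
          · intro x'
            by_cases h : (x', y) ∈ U
            · simpa [h] using hU.2 x'
            · simp [h]
      · refine ⟨{(x, y)}, ⟨@isClosed_singleton _ tG _ _, ?_⟩, rfl,
          Set.univ, isOpen_univ, trivial, ?_⟩
        · rw [ho]
          constructor
          · simp [Ne.symm hy]
          · intro x'
            apply aux_closed hp
            simp [Ne.symm hy]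
        · rintro w _ rfl
          exact hz
  · letI := glueFamTop X P tX tP
    letI tG := glueTop X P p
    refine (@aux_quot _ _ (sigmaTop _ _) tG _).2 ⟨?_, ?_⟩
    · rintro ⟨x, y⟩
      exact ⟨⟨some x, y⟩, rfl⟩
    · intro s
      refine Iff.trans ?_ isOpen_sigma_iff.symm
      constructor
      · rintro ⟨h1, h2⟩ (_ | x)
        · exact h1
        · exact h2 x
      · intro h
        exact ⟨h none, fun x => h (some x)⟩

end Helpers

/-- Every hereditary AD-class in an epireflective class of Hausdorff
spaces (containing a space with two points) is closed under prime factors. -/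
theorem statement7 (𝒜 ℬ : SpaceClass.{u})
    (hA : IsEpireflectiveClass 𝒜)
    (hT2 : ∀ (X : Type u) (tX : TopologicalSpace X), 𝒜 X tX → @T2Space X tX)
    (hA2 : ∃ (X : Type u) (tX : TopologicalSpace X), 𝒜 X tX ∧ ∃ x y : X, x ≠ y)
    (hB : IsADClass 𝒜 ℬ)
    (hher : IsHereditary ℬ) :
    ∀ (X : Type u) (tX : TopologicalSpace X) (a : X),
      ℬ X tX → ℬ X (primeFactor tX a) := by
  classical
  intro X tX a hX
  haveI := hT2 X tX (hB.subset _ _ hX)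
  have hpt : ∀ y, y ≠ a → IsOpen[primeFactor tX a] {y} := by
    intro y hy h
    exact absurd h (Ne.symm hy)
  have hT1 : @T1Space X (primeFactor tX a) := by
    refine @T1Space.mk _ (primeFactor tX a) fun y => ?_
    refine @IsClosed.mk _ (primeFactor tX a) _ ?_
    intro h
    exact isOpen_compl_singleton.mem_nhds h
  have hXA : 𝒜 X (primeFactor tX a) :=
    @aux_prime 𝒜 hA hT2 hA2 X (primeFactor tX a) hT1 a hpt
  by_cases ha : IsOpen {a}
  · have h1 := hher X tX {a} ⟨a, rfl⟩ hX
    have h2 := hB.sums X (fun _ => ({a} : Set X)) (fun _ => inferInstance) (fun _ => h1)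
    refine hB.divisible _ _ _ (primeFactor tX a) Sigma.fst h2 hXA ?_
    refine (@aux_quot _ _ (sigmaTop _ _) (primeFactor tX a) _).2 ⟨?_, ?_⟩
    · intro x
      exact ⟨⟨x, ⟨a, rfl⟩⟩, rfl⟩
    · intro s
      refine iff_of_true ?_ ?_
      · intro h
        exact Filter.mem_of_superset (ha.mem_nhds rfl) (by simpa using h)
      · exact isOpen_sigma_iff.2 fun i => isOpen_const (p := i ∈ s)
  · obtain ⟨P, tP, p, hP, hPT1, hp, hpo⟩ := aux_exists_prime hA hT2 hA2 hB hher X hX a ha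
    obtain ⟨x1, hx1⟩ : ∃ x1, x1 ≠ a := by
      by_contra! hc
      apply ha
      have : ({a} : Set X) = Set.univ := by
        ext x; simp [hc x]
      rw [this]
      exact isOpen_univ
    have hacc : ∀ U : Set P, IsOpen U → p ∈ U → ∃ y ∈ U, y ≠ p := by
      intro U hU hpU
      by_contra! hc
      apply hpo
      have : U = {p} := by
        ext x
        exact ⟨fun h => hc x h, fun h => by rw [h]; exact hpU⟩
      rwa [← this]
    have hG := aux_glue hA hB p hX hP hp hx1
    let S : Set (X × P) := {g | g = (a, p) ∨ g.2 ≠ p}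
    have hS := hher _ _ S ⟨(a, p), Or.inl rfl⟩ hG
    refine hB.divisible _ _ _ (primeFactor tX a) (fun g : S => g.1.1) hS hXA ?_
    refine (@aux_quot _ _ (TopologicalSpace.induced Subtype.val (glueTop X P p))
      (primeFactor tX a) _).2 ⟨?_, ?_⟩
    · intro x
      obtain ⟨y, -, hy⟩ := hacc Set.univ isOpen_univ trivial
      exact ⟨⟨(x, y), Or.inr hy⟩, rfl⟩
    · intro U
      refine Iff.trans ?_ (@isOpen_induced_iff _ _ (glueTop X P p) _ _).symm
      constructor
      · intro hU
        obtain ⟨V, hV, hVU, haV⟩ : ∃ V : Set X, IsOpen V ∧ V ⊆ U ∧ (a ∈ U → a ∈ V) := by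
          by_cases h : a ∈ U
          · obtain ⟨V, hVU, hV, haV⟩ := mem_nhds_iff.1 (hU h)
            exact ⟨V, hV, hVU, fun _ => haV⟩
          · exact ⟨∅, isOpen_empty, Set.empty_subset _, fun h' => absurd h' h⟩
        refine ⟨{g | g.1 ∈ U ∧ (g.2 ≠ p ∨ g.1 ∈ V)}, ⟨?_, ?_⟩, ?_⟩
        · have : {x | (x, p) ∈ {g : X × P | g.1 ∈ U ∧ (g.2 ≠ p ∨ g.1 ∈ V)}} = V := by
            ext x
            simp only [Set.mem_setOf_eq, ne_eq, not_true_eq_false, false_or]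
            exact ⟨fun h => h.2, fun h => ⟨hVU h, h⟩⟩
          rw [this]
          exact hV
        · intro x
          by_cases hxV : x ∈ V
          · simp [hxV]
          · apply aux_closed hp
            simp [hxV]
        · ext ⟨g, hg⟩
          simp only [Set.mem_preimage, Set.mem_setOf_eq]
          constructor
          · exact fun h => h.1
          · intro h
            refine ⟨h, ?_⟩
            rcases hg with rfl | hg
            · exact Or.inr (haV h)
            · exact Or.inl hg
      · rintro ⟨W, ⟨hW1, hW2⟩, hW⟩ haU
        have haW : (a, p) ∈ W := by
          have : (⟨(a, p), Or.inl rfl⟩ : S) ∈ (fun g : S => g.1.1) ⁻¹' U := haU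
          rw [← hW] at this
          exact this
        refine Filter.mem_of_superset (hW1.mem_nhds haW) ?_
        intro x hx
        obtain ⟨y, hy, hyp⟩ := hacc _ (hW2 x) hx
        have : (⟨(x, y), Or.inr hyp⟩ : S) ∈ Subtype.val ⁻¹' W := hy
        rw [hW] at this
        exact this
end

section
/- Let 𝒜 be an epireflective class of topological spaces in which every member is a T0 space and which contains a space with at least two points, and let ℬ be a hereditary AD-class in 𝒜 that contains at least one prime space. Then the class CH(ℬ) of all topological spaces homeomorphic to a quotient of a topological sum of members of ℬ is hereditary: every nonempty subspace of a member of CH(ℬ) again belongs to CH(ℬ). -/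
open Topology

universe u v w

/-- The coreflective hull of `ℬ` in `Top`: the class of spaces that are quotients of
topological sums of families of members of `ℬ`. -/
def corefHull (ℬ : SpaceClass.{u}) : SpaceClass.{u} := fun Z tZ =>
  ∃ (ι : Type u) (Y : ι → Type u) (t : ∀ i, TopologicalSpace (Y i))
    (q : (Σ i, Y i) → Z),
    (∀ i, ℬ (Y i) (t i)) ∧ @IsQuotientMap _ _ (sigmaTop Y t) tZ q

section Helpers

theorem quot_iff {X Y : Type*} [tX : TopologicalSpace X] [tY : TopologicalSpace Y] {f : X → Y}
    (h : Function.Surjective f ∧ ∀ U : Set Y, IsOpen U ↔ IsOpen (f ⁻¹' U)) :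
    IsQuotientMap f := by
  refine (isQuotientMap_iff f).2 ⟨⟨?_⟩, h.1⟩
  exact TopologicalSpace.ext_iff.2 fun U => (h.2 U).trans isOpen_coinduced.symm

/-- All members of the class are T1. -/
def AllT1 (𝒜 : SpaceClass.{u}) : Prop :=
  ∀ (X : Type u) (tX : TopologicalSpace X), 𝒜 X tX → @T1Space X tX

theorem exists_two (𝒜 : SpaceClass.{u})
    (hT0 : ∀ (X : Type u) (tX : TopologicalSpace X), 𝒜 X tX → @T0Space X tX)
    (hA2 : ∃ (X : Type u) (tX : TopologicalSpace X), 𝒜 X tX ∧ ∃ x y : X, x ≠ y) :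
    ∃ (D : Type u) (tD : TopologicalSpace D) (d0 d1 : D) (O : Set D), 𝒜 D tD ∧ IsOpen O ∧
      d1 ∈ O ∧ d0 ∉ O ∧ ∀ (Y : Type u) (_ : TopologicalSpace Y) (C : Set Y), IsOpen C →
        (AllT1 𝒜 → IsClosed C) → ∀ f : Y → D, (∀ y ∈ C, f y = d1) → (∀ y ∉ C, f y = d0) →
          Continuous f := by
  by_cases h : AllT1 𝒜
  · obtain ⟨D, tD, hD, x, y, hxy⟩ := hA2
    have := h D tD hD
    refine ⟨D, tD, x, y, {x}ᶜ, hD, isOpen_compl_singleton, ?_, ?_, ?_⟩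
    · simpa using hxy.symm
    · simp
    · intro Y tY C hC hC' f h1 h0
      have hcl := hC' h
      refine continuous_def.2 fun V _ => isOpen_iff_mem_nhds.2 fun z hz => ?_
      by_cases hzC : z ∈ C
      · refine Filter.mem_of_superset (hC.mem_nhds hzC) fun t ht => ?_
        simpa [h1 t ht, h1 z hzC] using hz
      · refine Filter.mem_of_superset (hcl.isOpen_compl.mem_nhds hzC) fun t ht => ?_
        simpa [h0 t ht, h0 z hzC] using hz
  · have h' := h
    unfold AllT1 at h'
    push Not at h'
    obtain ⟨D, tD, hD, hn⟩ := h'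
    have := hT0 D tD hD
    rw [t1Space_iff_specializes_imp_eq] at hn
    push Not at hn
    obtain ⟨x, y, hxy, hne⟩ := hn
    have hns : ¬ y ⤳ x := fun hyx => hne (hxy.antisymm hyx).eq
    rw [specializes_iff_forall_open] at hns
    push Not at hns
    obtain ⟨O, hO, hxO, hyO⟩ := hns
    refine ⟨D, tD, y, x, O, hD, hO, hxO, hyO, ?_⟩
    intro Y tY C hC _ f h1 h0
    refine continuous_def.2 fun V hV => isOpen_iff_mem_nhds.2 fun z hz => ?_
    by_cases hzC : z ∈ C
    · refine Filter.mem_of_superset (hC.mem_nhds hzC) fun t ht => ?_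
      have hz' : f z ∈ V := hz
      rw [h1 z hzC] at hz'
      simpa [h1 t ht] using hz'
    · have hz' : f z ∈ V := hz
      rw [h0 z hzC] at hz'
      refine Filter.univ_mem' fun t => ?_
      by_cases ht : t ∈ C
      · simpa [h1 t ht] using hxy.mem_open hV hz'
      · simpa [h0 t ht] using hz'

theorem mem_of_inducing (𝒜 : SpaceClass.{u}) (hA : IsEpireflectiveClass 𝒜)
    (Y : Type u) [tY : TopologicalSpace Y] [T0Space Y] (ι : Type u) (Z : ι → Type u)
    [t : ∀ i, TopologicalSpace (Z i)] (hZ : ∀ i, 𝒜 (Z i) (t i)) (F : Y → ∀ i, Z i)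
    (hF : IsInducing F) : 𝒜 Y tY := by
  have h1 := hA.subspace _ _ (Set.range F) (hA.prod ι Z t hZ)
  exact hA.homeo _ _ _ _ ⟨hF.isEmbedding.toHomeomorph.symm⟩ h1

theorem mem_of_base (𝒜 : SpaceClass.{u}) (hA : IsEpireflectiveClass 𝒜)
    (hT0 : ∀ (X : Type u) (tX : TopologicalSpace X), 𝒜 X tX → @T0Space X tX)
    (hA2 : ∃ (X : Type u) (tX : TopologicalSpace X), 𝒜 X tX ∧ ∃ x y : X, x ≠ y)
    (Y : Type u) [tY : TopologicalSpace Y] [T0Space Y] (X : Type u) [tX : TopologicalSpace X]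
    (hX : 𝒜 X tX) (r : Y → X) (hr : Continuous r)
    (hb : ∀ (U : Set Y), IsOpen U → ∀ y ∈ U, ∃ (W : Set X) (C : Set Y), IsOpen W ∧ IsOpen C ∧
      (AllT1 𝒜 → IsClosed C) ∧ r y ∈ W ∧ y ∈ C ∧ r ⁻¹' W ∩ C ⊆ U) : 𝒜 Y tY := by
  classical
  obtain ⟨D, tD, d0, d1, O, hD, hO, h1, h0, hc⟩ := exists_two 𝒜 hT0 hA2
  let ι := {C : Set Y // IsOpen C ∧ (AllT1 𝒜 → IsClosed C)}
  let Z : Option ι → Type u := fun o => o.elim X (fun _ => D)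
  letI t : ∀ o, TopologicalSpace (Z o) := fun o => match o with
    | none => tX
    | some _ => tD
  let F : Y → ∀ o, Z o := fun y o => match o with
    | none => r y
    | some C => if y ∈ C.1 then d1 else d0
  have hFc : Continuous F := by
    refine continuous_pi fun o => ?_
    rcases o with _ | C
    · exact hr
    · exact hc Y tY C.1 C.2.1 C.2.2 _ (fun y hy => if_pos hy) (fun y hy => if_neg hy)
  refine mem_of_inducing 𝒜 hA Y (Option ι) Z ?_ F ?_
  · rintro (_ | C)
    · exact hX
    · exact hD
  · refine isInducing_iff_nhds.2 fun y => le_antisymm (hFc.tendsto y).le_comap ?_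
    intro N hN
    obtain ⟨U, hUN, hU, hyU⟩ := mem_nhds_iff.1 hN
    obtain ⟨W, C, hW, hC, hC', hyW, hyC, hsub⟩ := hb U hU y hyU
    let c : Option ι := some ⟨C, hC, hC'⟩
    have e1 : {g : ∀ o, Z o | g none ∈ (W : Set (Z none))} ∈ 𝓝 (F y) :=
      IsOpen.mem_nhds (IsOpen.preimage (continuous_apply (A := Z) none) hW) hyW
    have e2 : {g : ∀ o, Z o | g c ∈ (O : Set (Z c))} ∈ 𝓝 (F y) := by
      refine IsOpen.mem_nhds (IsOpen.preimage (continuous_apply (A := Z) c) hO) ?_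
      change (if y ∈ C then d1 else d0) ∈ O
      rwa [if_pos hyC]
    refine ⟨_, Filter.inter_mem e1 e2, ?_⟩
    rintro z ⟨hz1, hz2⟩
    refine hUN (hsub ⟨hz1, ?_⟩)
    by_contra hzC
    have : (if z ∈ C then d1 else d0) ∈ O := hz2
    rw [if_neg hzC] at this
    exact h0 this

theorem mem_of_final (𝒜 ℬ : SpaceClass.{u}) (hB : IsADClass 𝒜 ℬ)
    (Y : Type u) [tY : TopologicalSpace Y] (hY : 𝒜 Y tY) (ι : Type u) (Z : ι → Type u)
    [t : ∀ i, TopologicalSpace (Z i)] (hZ : ∀ i, ℬ (Z i) (t i)) (f : ∀ i, Z i → Y)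
    (hs : ∀ y, ∃ i z, f i z = y) (hf : ∀ U : Set Y, IsOpen U ↔ ∀ i, IsOpen (f i ⁻¹' U)) :
    ℬ Y tY := by
  refine hB.divisible _ Y _ tY (fun p : Σ i, Z i => f p.1 p.2) (hB.sums ι Z t hZ) hY ?_
  change IsQuotientMap (fun p : Σ i, Z i => f p.1 p.2)
  refine quot_iff ⟨fun y => ?_, fun U => ?_⟩
  · obtain ⟨i, z, h⟩ := hs y
    exact ⟨⟨i, z⟩, h⟩
  · rw [hf, isOpen_sigma_iff]
    rfl

/-- The prime factor as a type synonym. -/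
def PF (X : Type u) (_ : X) : Type u := X

instance (X : Type u) [t : TopologicalSpace X] (a : X) : TopologicalSpace (PF X a) :=
  primeFactor t a

theorem isOpen_PF {X : Type u} [TopologicalSpace X] {a : X} {U : Set X} :
    IsOpen (X := PF X a) U ↔ (a ∈ U → U ∈ 𝓝 a) := Iff.rfl

theorem PF_mem (𝒜 : SpaceClass.{u}) (hA : IsEpireflectiveClass 𝒜)
    (hT0 : ∀ (X : Type u) (tX : TopologicalSpace X), 𝒜 X tX → @T0Space X tX)
    (hA2 : ∃ (X : Type u) (tX : TopologicalSpace X), 𝒜 X tX ∧ ∃ x y : X, x ≠ y)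
    (X : Type u) [tX : TopologicalSpace X] (hX : 𝒜 X tX) (a : X) :
    𝒜 (PF X a) inferInstance := by
  have := hT0 X tX hX
  let r : PF X a → X := fun x => x
  have hr : Continuous r := continuous_def.2 fun U hU => (isOpen_PF (X := X) (a := a)).2 fun h => hU.mem_nhds h
  have : T0Space (PF X a) := t0Space_of_injective_of_continuous (f := r) (fun _ _ h => h) hr
  refine mem_of_base 𝒜 hA hT0 hA2 (PF X a) X hX r hr ?_
  intro U hU y hy
  by_cases hya : y = a
  · rw [hya] at hy
    refine ⟨Set.univ, U, isOpen_univ, hU, fun _ => ?_, trivial, ?_, Set.inter_subset_right⟩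
    · exact ⟨(isOpen_PF (X := X) (a := a)).2 fun h => absurd hy h⟩
    · rw [hya]
      exact hy
  · refine ⟨Set.univ, {y}, isOpen_univ, (isOpen_PF (X := X) (a := a)).2 fun h => absurd h.symm hya, fun h => ?_,
      trivial, rfl, ?_⟩
    · have := h X tX hX
      exact ⟨(isOpen_PF (X := X) (a := a)).2 fun _ =>
        (isOpen_compl_singleton (X := X)).mem_nhds (Ne.symm hya)⟩
    · rintro z ⟨-, rfl⟩
      exact hy

/-- `X` with a copy of `P` glued at its point `b` to every point of `X`. -/
def GlueSp (X P : Type u) (_ : P) : Type u := X × P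

instance (X P : Type u) [TopologicalSpace X] [TopologicalSpace P] (b : P) :
    TopologicalSpace (GlueSp X P b) where
  IsOpen U := IsOpen {x : X | ((x, b) : X × P) ∈ U} ∧
    ∀ x : X, ((x, b) : X × P) ∈ U → {p : P | ((x, p) : X × P) ∈ U} ∈ 𝓝 b
  isOpen_univ := ⟨isOpen_univ, fun _ _ => Filter.univ_mem⟩
  isOpen_inter := fun _ _ hU hV =>
    ⟨hU.1.inter hV.1, fun x hx => Filter.inter_mem (hU.2 x hx.1) (hV.2 x hx.2)⟩
  isOpen_sUnion := fun S hS => by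
    constructor
    · have : {x : X | ((x, b) : X × P) ∈ ⋃₀ S} = ⋃ U ∈ S, {x : X | ((x, b) : X × P) ∈ U} := by
        ext x
        refine Iff.trans ?_ Set.mem_iUnion₂.symm
        exact ⟨fun ⟨U, hU, h⟩ => ⟨U, hU, h⟩, fun ⟨U, hU, h⟩ => ⟨U, hU, h⟩⟩
      rw [this]
      exact isOpen_biUnion fun U hU => (hS U hU).1
    · rintro x ⟨U, hU, hx⟩
      exact Filter.mem_of_superset ((hS U hU).2 x hx) fun p hp => ⟨U, hU, hp⟩

theorem isOpen_Glue {X P : Type u} [TopologicalSpace X] [TopologicalSpace P] {b : P}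
    {U : Set (X × P)} : IsOpen (X := GlueSp X P b) U ↔ IsOpen {x : X | (x, b) ∈ U} ∧
      ∀ x : X, (x, b) ∈ U → {p : P | (x, p) ∈ U} ∈ 𝓝 b := Iff.rfl

theorem isOpen_Glue_of_not {X P : Type u} [TopologicalSpace X] [TopologicalSpace P] {b : P}
    {U : Set (X × P)} (h : ∀ x, (x, b) ∉ U) : IsOpen (X := GlueSp X P b) U := by
  refine isOpen_Glue.2 ⟨?_, fun x hx => absurd hx (h x)⟩
  have : {x : X | (x, b) ∈ U} = ∅ := by
    ext x
    simpa using h x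
  rw [this]
  exact isOpen_empty

theorem Glue_mem (𝒜 : SpaceClass.{u}) (hA : IsEpireflectiveClass 𝒜)
    (hT0 : ∀ (X : Type u) (tX : TopologicalSpace X), 𝒜 X tX → @T0Space X tX)
    (hA2 : ∃ (X : Type u) (tX : TopologicalSpace X), 𝒜 X tX ∧ ∃ x y : X, x ≠ y)
    (X P : Type u) [tX : TopologicalSpace X] [tP : TopologicalSpace P] (hX : 𝒜 X tX)
    (hP : 𝒜 P tP) (b : P) : 𝒜 (GlueSp X P b) inferInstance := by
  have := hT0 X tX hX
  let r : GlueSp X P b → X := fun y => y.1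
  have hr : Continuous r := continuous_def.2 fun U hU => isOpen_Glue.2
    ⟨hU, fun x hx => Filter.univ_mem' fun p => hx⟩
  have hsing : ∀ x p, p ≠ b → IsOpen (X := GlueSp X P b) ({(x, p)} : Set (X × P)) := by
    intro x p hp
    refine isOpen_Glue_of_not fun z hz => hp ?_
    exact (congrArg Prod.snd (Set.mem_singleton_iff.1 hz)).symm
  have : T0Space (GlueSp X P b) := by
    refine ⟨?_⟩
    rintro ⟨x, p⟩ ⟨x', p'⟩ h
    by_cases hp : p = b
    · by_cases hp' : p' = b
      · have : x = x' := (h.map hr).eq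
        rw [this, hp, hp']
      · exact ((h.mem_open_iff (hsing x' p' hp')).2 rfl)
    · exact ((h.mem_open_iff (hsing x p hp)).1 rfl).symm
  refine mem_of_base 𝒜 hA hT0 hA2 (GlueSp X P b) X hX r hr ?_
  rintro U hU ⟨x, p⟩ hy
  by_cases hpb : p = b
  · subst hpb
    let A : Set (X × P) := {y | y.2 ≠ p ∧ (y.1, p) ∈ U ∧ y ∉ U}
    refine ⟨{x | (x, p) ∈ U}, Aᶜ, hU.1, ?_, fun _ => ?_, hy, fun h => h.1 rfl, ?_⟩
    · refine isOpen_Glue.2 ⟨?_, fun z _ => ?_⟩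
      · change IsOpen {x : X | (x, p) ∈ (Aᶜ : Set (X × P))}
        have : {x : X | (x, p) ∈ Aᶜ} = Set.univ := by
          ext z
          simp [A]
        exact this ▸ (isOpen_univ : IsOpen (Set.univ : Set X))
      · by_cases hz : (z, p) ∈ U
        · exact Filter.mem_of_superset (hU.2 z hz) fun p' hp' h => h.2.2 hp'
        · exact Filter.univ_mem' fun p' h => hz h.2.1
    · refine ⟨?_⟩
      change IsOpen (X := GlueSp X P p) (Aᶜᶜ : Set (X × P))
      rw [compl_compl]
      exact isOpen_Glue_of_not fun x h => h.1 rfl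
    · rintro ⟨z, p'⟩ ⟨h1, h2⟩
      by_contra hn
      refine h2 ⟨fun h => ?_, h1, hn⟩
      have h' : p' = p := h
      subst h'
      exact hn h1
  · refine ⟨Set.univ, {((x, p) : X × P)}, isOpen_univ, hsing x p hpb, fun h => ?_, trivial, rfl, ?_⟩
    · have := h P tP hP
      refine ⟨isOpen_Glue.2 ⟨?_, fun z _ => ?_⟩⟩
      · change IsOpen {x' : X | (x', b) ∈ ({(x, p)}ᶜ : Set (X × P))}
        have : {x' : X | (x', b) ∈ ({(x, p)}ᶜ : Set (X × P))} = Set.univ := by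
          ext z
          simp [Ne.symm hpb]
        rw [this]
        exact isOpen_univ
      · refine Filter.mem_of_superset (isOpen_compl_singleton.mem_nhds (Ne.symm hpb)) ?_
        intro p' hp' h
        exact hp' (congrArg Prod.snd (Set.mem_singleton_iff.1 h))
    · rintro z ⟨-, rfl⟩
      exact hy

theorem Glue_memB (𝒜 ℬ : SpaceClass.{u}) (hA : IsEpireflectiveClass 𝒜)
    (hT0 : ∀ (X : Type u) (tX : TopologicalSpace X), 𝒜 X tX → @T0Space X tX)
    (hA2 : ∃ (X : Type u) (tX : TopologicalSpace X), 𝒜 X tX ∧ ∃ x y : X, x ≠ y)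
    (hB : IsADClass 𝒜 ℬ)
    (X P : Type u) [tX : TopologicalSpace X] [tP : TopologicalSpace P] (hX : ℬ X tX)
    (hP : ℬ P tP) (b : P) (hb : ∀ p ≠ b, IsOpen {p}) : ℬ (GlueSp X P b) inferInstance := by
  let Z : Option X → Type u := fun o => o.elim X (fun _ => P)
  letI t : ∀ o, TopologicalSpace (Z o) := fun o => match o with
    | none => tX
    | some _ => tP
  refine mem_of_final 𝒜 ℬ hB (GlueSp X P b) (Glue_mem 𝒜 hA hT0 hA2 X P (hB.subset _ _ hX)
    (hB.subset _ _ hP) b) (Option X) Z ?_ (fun o => match o with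
      | none => fun x : X => ((x, b) : X × P)
      | some x => fun p : P => ((x, p) : X × P)) ?_ ?_
  · rintro (_ | x)
    · exact hX
    · exact hP
  · rintro ⟨x, p⟩
    exact ⟨some x, p, rfl⟩
  · intro U
    refine isOpen_Glue.trans ⟨?_, ?_⟩
    · rintro ⟨h1, h2⟩ (_ | x)
      · exact h1
      · change IsOpen {p : P | ((x, p) : X × P) ∈ U}
        refine isOpen_iff_mem_nhds.2 fun p hp => ?_
        by_cases hpb : p = b
        · subst hpb
          exact h2 x hp
        · refine Filter.mem_of_superset ((hb p hpb).mem_nhds rfl) ?_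
          rintro _ rfl
          exact hp
    · intro h
      exact ⟨h none, fun x hx => IsOpen.mem_nhds (X := P) (h (some x)) hx⟩

theorem PF_memB (𝒜 ℬ : SpaceClass.{u}) (hA : IsEpireflectiveClass 𝒜)
    (hT0 : ∀ (X : Type u) (tX : TopologicalSpace X), 𝒜 X tX → @T0Space X tX)
    (hA2 : ∃ (X : Type u) (tX : TopologicalSpace X), 𝒜 X tX ∧ ∃ x y : X, x ≠ y)
    (hB : IsADClass 𝒜 ℬ) (hher : IsHereditary ℬ)
    (hprime : ∃ (P : Type u) (tP : TopologicalSpace P), ℬ P tP ∧ IsPrimeSpace P tP)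
    (X : Type u) [tX : TopologicalSpace X] (hX : ℬ X tX) (a : X) :
    ℬ (PF X a) inferInstance := by
  obtain ⟨P, tP, hP, b, hb, hbu⟩ := hprime
  have hb' : ∀ p ≠ b, IsOpen {p} := fun p hp => by
    by_contra h
    exact hp (hbu p h)
  have hex : ∀ N ∈ 𝓝 b, ∃ p ∈ N, p ≠ b := by
    intro N hN
    by_contra! h
    apply hb
    refine isOpen_singleton_iff_nhds_eq_pure b |>.2 (le_antisymm ?_ (pure_le_nhds b))
    exact Filter.le_pure_iff.2 (Filter.mem_of_superset hN h)
  have hG := Glue_memB 𝒜 ℬ hA hT0 hA2 hB X P hX hP b hb'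
  let S : Set (GlueSp X P b) := {y : X × P | y.2 = b → y.1 = a}
  have hS := hher _ _ S ⟨((a, b) : X × P), fun _ => rfl⟩ hG
  refine hB.divisible S (PF X a) _ _ (fun y => (y.1 : X × P).1) hS
    (PF_mem 𝒜 hA hT0 hA2 X (hB.subset _ _ hX) a) ?_
  refine quot_iff ⟨fun x => ?_, fun V => ?_⟩
  · obtain ⟨p, -, hp⟩ := hex Set.univ Filter.univ_mem
    exact ⟨⟨((x, p) : X × P), fun h => absurd h hp⟩, rfl⟩
  · refine (isOpen_PF (X := X) (a := a)).trans ⟨fun h => ?_, fun h ha => ?_⟩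
    · by_cases ha : a ∈ V
      · obtain ⟨W, hWV, hW, haW⟩ := mem_nhds_iff (X := X) |>.1 (h ha)
        refine isOpen_induced_iff.2 ⟨{y : X × P | y.1 ∈ V ∧ (y.2 = b → y.1 ∈ W)}, ?_, ?_⟩
        · refine isOpen_Glue.2 ⟨?_, fun x hx => ?_⟩
          · have hEq : {x : X | (x, b) ∈ {y : X × P | y.1 ∈ V ∧ (y.2 = b → y.1 ∈ W)}} = W := by
              ext x
              exact ⟨fun h => h.2 rfl, fun h => ⟨hWV h, fun _ => h⟩⟩
            exact hEq.symm ▸ hW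
          · exact Filter.univ_mem' fun p => ⟨hx.1, fun _ => hx.2 rfl⟩
        · ext ⟨⟨x, p⟩, hy⟩
          refine ⟨fun h => h.1, fun h => ⟨h, fun hp => ?_⟩⟩
          have : x = a := hy hp
          change x ∈ W
          rwa [this]
      · refine isOpen_induced_iff.2 ⟨{y : X × P | y.1 ∈ V ∧ y.2 ≠ b}, ?_, ?_⟩
        · exact isOpen_Glue_of_not fun x h => h.2 rfl
        · ext ⟨⟨x, p⟩, hy⟩
          refine ⟨fun h => h.1, fun h => ⟨h, fun hp => ha ?_⟩⟩
          have : x = a := hy hp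
          rw [← this]
          exact h
    · obtain ⟨U, hU, hUV⟩ := isOpen_induced_iff.1 h
      have hmem : ∀ (x : X) (p : P) (hy : ((x, p) : X × P) ∈ S),
          (((x, p) : X × P) ∈ U ↔ x ∈ V) := fun x p hy =>
        Set.ext_iff.1 hUV ⟨((x, p) : X × P), hy⟩
      have hU' := isOpen_Glue.1 hU
      refine Filter.mem_of_superset (hU'.1.mem_nhds ((hmem a b fun _ => rfl).2 ha)) ?_
      intro x hx
      obtain ⟨p, hp, hpb⟩ := hex _ (hU'.2 x hx)
      exact (hmem x p fun h => absurd h hpb).1 hp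

/-- End of a word. -/
def wordEnd {X Z : Type u} (q : X → Z) (c : Z) : List (X × X) → Z
  | [] => c
  | e :: _ => q e.2

/-- The tree space over a map `q : X → Z`. -/
def TreeSp {X Z : Type u} (_ : X → Z) (_ : Z) : Type u := List (X × X)

instance {X Z : Type u} [TopologicalSpace X] (q : X → Z) (c : Z) :
    TopologicalSpace (TreeSp q c) where
  IsOpen U := ∀ w : List (X × X), w ∈ U → ∀ x, q x = wordEnd q c w →
    {y | y = x ∨ ((x, y) :: w : List (X × X)) ∈ U} ∈ 𝓝 x
  isOpen_univ := fun _ _ _ _ => Filter.univ_mem' fun _ => Or.inr trivial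
  isOpen_inter := fun U V hU hV w hw x hx => by
    filter_upwards [hU w hw.1 x hx, hV w hw.2 x hx] with y h1 h2
    rcases h1 with h1 | h1
    · exact Or.inl h1
    · rcases h2 with h2 | h2
      · exact Or.inl h2
      · exact Or.inr ⟨h1, h2⟩
  isOpen_sUnion := fun S hS w hw x hx => by
    obtain ⟨U, hU, hw⟩ := hw
    filter_upwards [hS U hU w hw x hx] with y h
    exact h.imp id fun h => ⟨U, hU, h⟩

theorem isOpen_Tree {X Z : Type u} [TopologicalSpace X] {q : X → Z} {c : Z}
    {U : Set (List (X × X))} : IsOpen (X := TreeSp q c) U ↔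
    ∀ w, w ∈ U → ∀ x, q x = wordEnd q c w → {y | y = x ∨ (x, y) :: w ∈ U} ∈ 𝓝 x := Iff.rfl

theorem Tree_mem (𝒜 : SpaceClass.{u}) (hA : IsEpireflectiveClass 𝒜)
    (hT0 : ∀ (X : Type u) (tX : TopologicalSpace X), 𝒜 X tX → @T0Space X tX)
    (hA2 : ∃ (X : Type u) (tX : TopologicalSpace X), 𝒜 X tX ∧ ∃ x y : X, x ≠ y)
    (X Z : Type u) [tX : TopologicalSpace X] (hX : 𝒜 X tX) (q : X → Z) (c : Z) (x0 : X) :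
    𝒜 (TreeSp q c) inferInstance := by
  have : T0Space (TreeSp q c) := by
    refine ⟨?_⟩
    have hop : ∀ w : List (X × X), IsOpen (X := TreeSp q c) {v : List (X × X) | w <:+ v} := by
      intro w
      refine isOpen_Tree.2 fun v hv x _ => Filter.univ_mem' fun y => Or.inr ?_
      exact List.IsSuffix.trans hv (List.suffix_cons _ _)
    intro w v h
    have h1 : List.IsSuffix (α := X × X) w v := (h.mem_open_iff (hop w)).1 (List.suffix_refl _)
    have h2 : List.IsSuffix (α := X × X) v w := (h.mem_open_iff (hop v)).2 (List.suffix_refl _)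
    exact h1.eq_of_length (le_antisymm h1.length_le h2.length_le)
  refine mem_of_base 𝒜 hA hT0 hA2 (TreeSp q c) X hX (fun _ => x0) continuous_const ?_
  intro U hU w hw
  let C : Set (List (X × X)) := {v | List.IsSuffix (α := X × X) w v ∧
    ∀ u : List (X × X), List.IsSuffix (α := X × X) w u → u <:+ v → u ∈ U}
  refine ⟨Set.univ, C, isOpen_univ, ?_, fun h => ?_, trivial, ⟨List.suffix_refl _, ?_⟩, ?_⟩
  · refine isOpen_Tree.2 fun v hv x hx => ?_
    have hvU : v ∈ U := hv.2 v hv.1 (List.suffix_refl _)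
    refine Filter.mem_of_superset (isOpen_Tree.1 hU v hvU x hx) ?_
    rintro y (hy | hy)
    · exact Or.inl hy
    · refine Or.inr ⟨hv.1.trans (List.suffix_cons _ _), fun u h1 h2 => ?_⟩
      rcases List.suffix_cons_iff.1 h2 with h2 | h2
      · rw [h2]
        exact hy
      · exact hv.2 u h1 h2
  · have := h X tX hX
    refine ⟨isOpen_Tree.2 fun v hv x hx => ?_⟩
    have key : ∀ y, (x, y) :: v ∈ C → w = ((x, y) :: v : List (X × X)) := by
      intro y hy
      rcases List.suffix_cons_iff.1 hy.1 with h2 | h2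
      · exact h2
      · exact absurd ⟨h2, fun u h3 h4 => hy.2 u h3 (h4.trans (List.suffix_cons _ _))⟩ hv
    by_cases hex : ∃ y0, y0 ≠ x ∧ w = ((x, y0) :: v : List (X × X))
    · obtain ⟨y0, hne, hw0⟩ := hex
      refine Filter.mem_of_superset (isOpen_compl_singleton.mem_nhds hne.symm) ?_
      intro y hy
      refine Or.inr fun hyC => hy ?_
      have : ((x, y) :: v : List (X × X)) = (x, y0) :: v := (key y hyC).symm.trans hw0
      exact congrArg Prod.snd (List.cons.inj this).1
    · refine Filter.univ_mem' fun y => ?_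
      by_cases hyx : y = x
      · exact Or.inl hyx
      · exact Or.inr fun hyC => hex ⟨y, hyx, key y hyC⟩
  · intro u h1 h2
    have : u = w := h2.eq_of_length (le_antisymm h2.length_le h1.length_le)
    rw [this]
    exact hw
  · rintro v ⟨-, hv⟩
    exact hv.2 v hv.1 (List.suffix_refl _)

theorem Tree_memB (𝒜 ℬ : SpaceClass.{u}) (hA : IsEpireflectiveClass 𝒜)
    (hT0 : ∀ (X : Type u) (tX : TopologicalSpace X), 𝒜 X tX → @T0Space X tX)
    (hA2 : ∃ (X : Type u) (tX : TopologicalSpace X), 𝒜 X tX ∧ ∃ x y : X, x ≠ y)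
    (hB : IsADClass 𝒜 ℬ) (hher : IsHereditary ℬ)
    (hprime : ∃ (P : Type u) (tP : TopologicalSpace P), ℬ P tP ∧ IsPrimeSpace P tP)
    (X Z : Type u) [tX : TopologicalSpace X] (hX : ℬ X tX) (q : X → Z)
    (hq : Function.Surjective q) (c : Z) : ℬ (TreeSp q c) inferInstance := by
  classical
  obtain ⟨x0, -⟩ := hq c
  refine mem_of_final 𝒜 ℬ hB (TreeSp q c)
    (Tree_mem 𝒜 hA hT0 hA2 X Z (hB.subset _ _ hX) q c x0)
    {i : List (X × X) × X // q i.2 = wordEnd q c i.1} (fun i => PF X i.1.2)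
    (fun i => PF_memB 𝒜 ℬ hA hT0 hA2 hB hher hprime X hX i.1.2)
    (fun i => fun y : X => (if y = i.1.2 then i.1.1 else (i.1.2, y) :: i.1.1 : List (X × X)))
    ?_ ?_
  · intro w
    obtain ⟨x, hx⟩ := hq (wordEnd q c w)
    exact ⟨⟨(w, x), hx⟩, (x : X), if_pos rfl⟩
  · intro U
    refine isOpen_Tree.trans ⟨fun h => ?_, fun h w hw x hx => ?_⟩
    · rintro ⟨⟨w, x⟩, hx⟩
      refine (isOpen_PF (X := X) (a := x)).2 fun hmem => ?_
      have hw : w ∈ U := by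
        have h' : (if x = x then w else (x, x) :: w : List (X × X)) ∈ U := hmem
        rwa [if_pos rfl] at h'
      filter_upwards [h w hw x hx] with y hy
      change (if y = x then w else (x, y) :: w : List (X × X)) ∈ U
      by_cases hyx : y = x
      · rwa [if_pos hyx]
      · rw [if_neg hyx]
        exact hy.resolve_left hyx
    · have h1 := (isOpen_PF (X := X) (a := x)).1 (h ⟨(w, x), hx⟩) (by
        change (if x = x then w else (x, x) :: w : List (X × X)) ∈ U
        rwa [if_pos rfl])
      filter_upwards [h1] with y hy
      by_cases hyx : y = x
      · exact Or.inl hyx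
      · right
        have h' : (if y = x then w else (x, y) :: w : List (X × X)) ∈ U := hy
        rwa [if_neg hyx] at h'

end Helpers

/-- If a hereditary AD-class `ℬ` (in an epireflective class `𝒜` of T0
spaces containing a space with two points) contains a prime space, then the
coreflective hull of `ℬ` in `Top` is hereditary. -/
theorem statement8 (𝒜 ℬ : SpaceClass.{u})
    (hA : IsEpireflectiveClass 𝒜)
    (hT0 : ∀ (X : Type u) (tX : TopologicalSpace X), 𝒜 X tX → @T0Space X tX)
    (hA2 : ∃ (X : Type u) (tX : TopologicalSpace X), 𝒜 X tX ∧ ∃ x y : X, x ≠ y)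
    (hB : IsADClass 𝒜 ℬ)
    (hher : IsHereditary ℬ)
    (hprime : ∃ (P : Type u) (tP : TopologicalSpace P), ℬ P tP ∧ IsPrimeSpace P tP) :
    IsHereditary (corefHull ℬ) := by
  intro Z tZ s hs hZ
  obtain ⟨ι, Y, t, q, hY, hq⟩ := hZ
  obtain ⟨c, hc⟩ := hs
  have hX := hB.sums ι Y t hY
  revert hq hX q
  generalize sigmaTop Y t = tX
  generalize (Σ i, Y i) = X at tX
  intro q hq hX
  have hT := Tree_memB 𝒜 ℬ hA hT0 hA2 hB hher hprime X Z hX q hq.surjective c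
  let e : TreeSp q c → Z := wordEnd q c
  have hcont : Continuous e := by
    refine continuous_def.2 fun V hV => isOpen_Tree.2 fun w hw x hx => ?_
    have : q ⁻¹' V ∈ 𝓝 x := (hV.preimage hq.continuous).mem_nhds (by
      change q x ∈ V
      rw [hx]
      exact hw)
    exact Filter.mem_of_superset this fun y hy => Or.inr hy
  have hopen : IsOpenMap e := by
    intro U hU
    rw [← hq.isOpen_preimage]
    refine isOpen_iff_mem_nhds.2 fun x hx => ?_
    obtain ⟨w, hw, hwx⟩ := hx
    refine Filter.mem_of_superset (isOpen_Tree.1 hU w hw x hwx.symm) ?_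
    rintro y (rfl | hy)
    · exact ⟨w, hw, hwx⟩
    · exact ⟨_, hy, rfl⟩
  have hsurj : Function.Surjective e := by
    intro z
    obtain ⟨x, hx⟩ := hq.surjective z
    exact ⟨([(x, x)] : List (X × X)), hx⟩
  have hS := hher _ _ (e ⁻¹' s) ⟨([] : List (X × X)), hc⟩ hT
  have hqm : IsQuotientMap (s.restrictPreimage e) :=
    (hopen.restrictPreimage s).isQuotientMap hcont.restrictPreimage
      (Set.restrictPreimage_surjective s hsurj)
  refine ⟨PUnit, fun _ => e ⁻¹' s, fun _ => inferInstance, fun p => s.restrictPreimage e p.2,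
    fun _ => hS, ?_⟩
  change IsQuotientMap (fun p : Σ _ : PUnit, e ⁻¹' s => s.restrictPreimage e p.2)
  refine quot_iff ⟨fun z => ?_, fun U => ?_⟩
  · obtain ⟨y, hy⟩ := hqm.surjective z
    exact ⟨⟨PUnit.unit, y⟩, hy⟩
  · rw [← hqm.isOpen_preimage, isOpen_sigma_iff]
    exact ⟨fun h _ => h, fun h => h PUnit.unit⟩
end

section
/- Let 𝒜 be an epireflective class of topological spaces in which every member is a T0 space and which contains a space with at least two points, and let ℬ be a hereditary AD-class in 𝒜. If ℬ contains at least one space which is not locally connected, then ℬ is closed under prime factors: X_a ∈ ℬ for every X ∈ ℬ and every a ∈ X. -/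
open Topology

universe u v w

theorem isQuot_of {X Y : Type u} {tX : TopologicalSpace X} {tY : TopologicalSpace Y} {f : X → Y}
    (h : Function.Surjective f ∧ ∀ s : Set Y, IsOpen s ↔ IsOpen (f ⁻¹' s)) : IsQuotientMap f :=
  ⟨isCoinducing_iff.2 fun s => (h.2 s).symm, h.1⟩

theorem mem_of_embedding {𝒜 : SpaceClass.{u}} (hA : IsEpireflectiveClass 𝒜)
    {Z M : Type u} [tZ : TopologicalSpace Z] [tM : TopologicalSpace M] (f : Z → M)
    (hf : IsEmbedding f) (hM : 𝒜 M tM) : 𝒜 Z tZ :=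
  hA.homeo _ _ _ _ ⟨hf.toHomeomorph.symm⟩ (hA.subspace M tM (Set.range f) hM)

theorem mem_of_maps {𝒜 : SpaceClass.{u}} (hA : IsEpireflectiveClass 𝒜)
    {Z M : Type u} [tZ : TopologicalSpace Z] [T0Space Z] [tM : TopologicalSpace M]
    (hM : 𝒜 M tM) (ι : Type u) (g : ι → Z → M) (hg : ∀ i, Continuous (g i))
    (h : ∀ (z : Z) (W : Set Z), IsOpen W → z ∈ W → ∃ i j U V, IsOpen U ∧ IsOpen V ∧
      g i z ∈ U ∧ g j z ∈ V ∧ ∀ w, g i w ∈ U → g j w ∈ V → w ∈ W) : 𝒜 Z tZ := by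
  have hc : Continuous (fun (z : Z) (i : ι) => g i z) := continuous_pi hg
  have hi : IsInducing (fun (z : Z) (i : ι) => g i z) := by
    refine ⟨le_antisymm hc.le_induced ?_⟩
    intro W hW
    refine (@isOpen_iff_forall_mem_open Z (TopologicalSpace.induced _ _) W).2 ?_
    intro z hz
    obtain ⟨i, j, U, V, hU, hV, h1, h2, h3⟩ := h z W hW hz
    refine ⟨{w | g i w ∈ U ∧ g j w ∈ V}, fun w hw => h3 w hw.1 hw.2, ?_, ⟨h1, h2⟩⟩
    refine isOpen_induced_iff.2 ⟨{m | m i ∈ U ∧ m j ∈ V}, ?_, rfl⟩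
    exact (hU.preimage (continuous_apply i)).inter (hV.preimage (continuous_apply j))
  exact mem_of_embedding hA _ hi.isEmbedding (hA.prod ι (fun _ => M) (fun _ => tM) fun _ => hM)

open Classical in
theorem ind_continuous {Z M : Type u} [TopologicalSpace Z] [TopologicalSpace M] (x y : M)
    {s : Set Z} (hs : IsClopen s) : Continuous (fun z => if z ∈ s then x else y) :=
  continuous_if (by simp [hs.frontier_eq]) continuousOn_const continuousOn_const

/-- T1 prime spaces belong to the class. -/
theorem prime_mem {𝒜 : SpaceClass.{u}} (hA : IsEpireflectiveClass 𝒜)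
    {M : Type u} [tM : TopologicalSpace M] (hM : 𝒜 M tM) (x y : M) (U : Set M)
    (hU : IsOpen U) (hx : x ∈ U) (hy : y ∉ U)
    {Z : Type u} [tZ : TopologicalSpace Z] (p : Z) (hp : ∀ z, z ≠ p → IsClopen {z}) :
    𝒜 Z tZ := by
  classical
  have h0 : ∀ s : Set Z, p ∉ s → IsOpen s := by
    intro s hs
    rw [← Set.biUnion_of_singleton s]
    exact isOpen_biUnion fun z hz => (hp z (fun e => hs (e ▸ hz))).isOpen
  have h1 : ∀ s : Set Z, p ∈ s → IsOpen s → IsClopen s := fun s hs ho =>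
    ⟨⟨h0 _ (fun h => h hs)⟩, ho⟩
  haveI : T0Space Z := by
    refine ⟨fun a b hab => ?_⟩
    by_contra hne
    by_cases ha : a = p
    · have hb : b ≠ p := fun e => hne (ha.trans e.symm)
      exact hne ((hab.mem_open_iff (hp b hb).isOpen).2 rfl)
    · exact hne ((hab.mem_open_iff (hp a ha).isOpen).1 rfl).symm
  refine mem_of_maps hA hM {s : Set Z // IsClopen s} (fun s z => if z ∈ s.1 then x else y)
    (fun s => ind_continuous x y s.2) ?_
  intro z W hW hz
  have : ∃ s : Set Z, IsClopen s ∧ z ∈ s ∧ s ⊆ W := by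
    by_cases h : z = p
    · exact ⟨W, h1 W (h ▸ hz) hW, hz, subset_rfl⟩
    · exact ⟨{z}, hp z h, rfl, by simpa using hz⟩
  obtain ⟨s, hs, hzs, hsW⟩ := this
  refine ⟨⟨s, hs⟩, ⟨s, hs⟩, U, U, hU, hU, by simp [hzs, hx], by simp [hzs, hx], ?_⟩
  intro w hw _
  by_contra hn
  have : w ∉ s := fun h => hn (hsW h)
  simp [this, hy] at hw

theorem exists_sep {M : Type u} [TopologicalSpace M] [T0Space M] {x y : M} (h : x ≠ y) :
    ∃ (a b : M) (U : Set M), IsOpen U ∧ a ∈ U ∧ b ∉ U := by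
  obtain ⟨U, hU, h⟩ := exists_isOpen_xor_mem h
  rcases h with h | h
  · exact ⟨x, y, U, hU, h.1, h.2⟩
  · exact ⟨y, x, U, hU, h.1, h.2⟩

theorem primeFactor_le {X : Type u} (tX : TopologicalSpace X) (a : X) :
    primeFactor tX a ≤ tX := fun _ hU ha => hU.mem_nhds ha

theorem primeFactor_mem {𝒜 : SpaceClass.{u}} (hA : IsEpireflectiveClass 𝒜)
    {X : Type u} [tX : TopologicalSpace X] [T0Space X] [Nontrivial X]
    (hX : 𝒜 X tX) (a : X) : 𝒜 X (primeFactor tX a) := by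
  classical
  by_cases h : ∀ x, x ≠ a → {x}ᶜ ∈ 𝓝 a
  · obtain ⟨x, y, hxy⟩ := exists_pair_ne X
    obtain ⟨b, c, U, hU, hb, hc⟩ := exists_sep hxy
    refine @prime_mem 𝒜 hA X tX hX b c U hU hb hc X (primeFactor tX a) a ?_
    intro z hz
    refine @And.intro (IsClosed[primeFactor tX a] {z}) (IsOpen[primeFactor tX a] {z}) ?_ ?_
    · exact (@isOpen_compl_iff _ _ (primeFactor tX a)).1 (fun _ => h z hz)
    · exact fun e => absurd e.symm hz
  · push Not at h
    obtain ⟨x, hxa, hx⟩ := h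
    have hax : ∀ V : Set X, IsOpen V → a ∈ V → x ∈ V := by
      intro V hV haV
      by_contra hn
      exact hx (Filter.mem_of_superset (hV.mem_nhds haV) (fun v hv e => hn (e ▸ hv)))
    obtain ⟨U, hU, hxU, haU⟩ : ∃ U : Set X, IsOpen U ∧ x ∈ U ∧ a ∉ U := by
      obtain ⟨U, hU, h⟩ := exists_isOpen_xor_mem hxa
      rcases h with h | h
      · exact ⟨U, hU, h.1, h.2⟩
      · exact absurd (hax U hU h.1) h.2
    have hT : @T0Space X (primeFactor tX a) :=
      @t0Space_of_injective_of_continuous X X (primeFactor tX a) tX id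
        Function.injective_id (continuous_id_of_le (primeFactor_le tX a)) _
    refine @mem_of_maps 𝒜 hA X X (primeFactor tX a) hT tX hX
      {s : Set X // IsOpen[primeFactor tX a] s} (fun s z => if z ∈ s.1 then x else a) ?_ ?_
    · rintro ⟨s, hs⟩
      refine @Continuous.mk _ _ (primeFactor tX a) _ _ fun V hV => ?_
      by_cases haV : a ∈ V
      · have : (fun z => if z ∈ s then x else a) ⁻¹' V = Set.univ := by
          ext z; by_cases hz : z ∈ s <;> simp [hz, haV, hax V hV haV]
        rw [this]; exact @isOpen_univ _ (primeFactor tX a)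
      · by_cases hxV : x ∈ V
        · have : (fun z => if z ∈ s then x else a) ⁻¹' V = s := by
            ext z; by_cases hz : z ∈ s <;> simp [hz, haV, hxV]
          rw [this]; exact hs
        · have : (fun z => if z ∈ s then x else a) ⁻¹' V = ∅ := by
            ext z; by_cases hz : z ∈ s <;> simp [hz, haV, hxV]
          rw [this]; exact @isOpen_empty _ (primeFactor tX a)
    · intro z W hW hz
      refine ⟨⟨W, hW⟩, ⟨W, hW⟩, U, U, hU, hU, by simp [hz, hxU], by simp [hz, hxU], ?_⟩
      intro w hw _
      by_contra hn
      simp [hn, haU] at hw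

/-! ### Existence of a prime space in the class -/

theorem prime_of_map {𝒜 ℬ : SpaceClass.{u}} (hA : IsEpireflectiveClass 𝒜)
    {M : Type u} [tM : TopologicalSpace M] (hM : 𝒜 M tM) (x y : M) (U : Set M)
    (hU : IsOpen U) (hx : x ∈ U) (hy : y ∉ U) (hB : IsADClass 𝒜 ℬ)
    {Z I : Type u} [tZ : TopologicalSpace Z] (hZ : ℬ Z tZ) (q : Z → I) (k : I)
    (h1 : ∀ i, i ≠ k → IsClopen (q ⁻¹' {i})) (h2 : ¬ IsOpen (q ⁻¹' {k})) :
    ∃ (P : Type u) (tP : TopologicalSpace P) (p : P), ℬ P tP ∧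
      (∀ z, z ≠ p → IsClopen {z}) ∧ ¬ IsOpen {p} := by
  have hk : k ∈ Set.range q := by
    by_contra hn
    apply h2
    have : q ⁻¹' {k} = ∅ := by
      ext z; simp only [Set.mem_preimage, Set.mem_singleton_iff, Set.mem_empty_iff_false, iff_false]
      exact fun e => hn ⟨z, e⟩
    rw [this]; exact isOpen_empty
  let f : Z → Set.range q := Set.rangeFactorization q
  letI tP : TopologicalSpace (Set.range q) := TopologicalSpace.coinduced f tZ
  have hf : IsQuotientMap f := ⟨⟨rfl⟩, Set.rangeFactorization_surjective⟩
  have hpre : ∀ i : Set.range q, f ⁻¹' {i} = q ⁻¹' {i.1} := by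
    intro i; ext z
    simp [f, Set.rangeFactorization, Subtype.ext_iff]
  have hcl : ∀ z : Set.range q, z ≠ ⟨k, hk⟩ → IsClopen {z} := by
    intro z hz
    have := h1 z.1 (fun e => hz (Subtype.ext e))
    rw [← hpre] at this
    exact ⟨hf.isClosed_preimage.1 this.1, hf.isOpen_preimage.1 this.2⟩
  refine ⟨Set.range q, tP, ⟨k, hk⟩, ?_, hcl, ?_⟩
  · exact hB.divisible Z _ tZ tP f hZ (prime_mem hA hM x y U hU hx hy ⟨k, hk⟩ hcl) hf
  · rw [← hf.isOpen_preimage, hpre]; exact h2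

theorem exists_map_of_clopens {Z : Type u} [TopologicalSpace Z] (ι : Type u) (F : ι → Set Z)
    (hF : ∀ i, IsClopen (F i)) (hn : ¬ IsOpen (⋂ i, F i)) :
    ∃ (q : Z → Option ι), (∀ i, i ≠ none → IsClopen (q ⁻¹' {i})) ∧
      ¬ IsOpen (q ⁻¹' {none}) := by
  classical
  obtain ⟨_, hwf⟩ := exists_wellFoundedLT ι
  obtain ⟨J, hJl, hJo, hJn⟩ : ∃ J : Set ι, (∀ j ∈ J, ∀ k, k ≤ j → k ∈ J) ∧
      (∀ j ∈ J, IsOpen (⋂ k : {k // k < j}, F k.1)) ∧ ¬ IsOpen (⋂ k : J, F k) := by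
    by_cases h : ∃ j, ¬ IsOpen (⋂ k : {k // k < j}, F k.1)
    · obtain ⟨j, hj, hmin⟩ := hwf.wf.has_min {j : ι | ¬ IsOpen (⋂ k : {k // k < j}, F k.1)} h
      refine ⟨{k | k < j}, fun a ha b hb => lt_of_le_of_lt hb ha, fun a ha => ?_, hj⟩
      by_contra hc
      exact hmin a hc ha
    · push Not at h
      refine ⟨Set.univ, fun _ _ _ _ => trivial, fun j _ => h j, ?_⟩
      convert hn using 2
      ext z; simp
  have key : ∀ z, (∃ j ∈ J, z ∉ F j) → ∃ j ∈ J, z ∉ F j ∧ ∀ k, k < j → z ∈ F k := by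
    rintro z h
    obtain ⟨j, ⟨hj1, hj2⟩, hmin⟩ := hwf.wf.has_min {j | j ∈ J ∧ z ∉ F j} h
    refine ⟨j, hj1, hj2, fun k hk => ?_⟩
    by_contra hc
    exact hmin k ⟨hJl j hj1 k hk.le, hc⟩ hk
  have : Nonempty ι := by
    by_contra hc
    rw [not_nonempty_iff] at hc
    exact hn (by simp)
  choose! m hm1 hm2 hm3 using key
  let q : Z → Option ι := fun z => if ∃ j ∈ J, z ∉ F j then some (m z) else none
  refine ⟨q, ?_, ?_⟩
  · rintro (_ | i) hi
    · exact absurd rfl hi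
    by_cases hiJ : i ∈ J
    · have : q ⁻¹' {some i} = (⋂ k : {k // k < i}, F k.1) ∩ (F i)ᶜ := by
        ext z
        simp only [q, Set.mem_preimage, Set.mem_singleton_iff, Set.mem_inter_iff, Set.mem_iInter,
          Set.mem_compl_iff]
        constructor
        · intro h
          split_ifs at h with h'
          obtain rfl := Option.some.inj h
          exact ⟨fun k => hm3 z h' k k.2, hm2 z h'⟩
        · rintro ⟨ha, hb⟩
          have h' : ∃ j ∈ J, z ∉ F j := ⟨i, hiJ, hb⟩
          rw [if_pos h']
          congr 1
          rcases lt_trichotomy (m z) i with h | h | h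
          · exact absurd (ha ⟨_, h⟩) (hm2 z h')
          · exact h
          · exact absurd (hm3 z h' i h) hb
      rw [this]
      exact ⟨(isClosed_iInter fun k : {k // k < i} => (hF k.1).1).inter (hF i).2.isClosed_compl,
        (hJo i hiJ).inter (hF i).1.isOpen_compl⟩
    · have : q ⁻¹' {some i} = ∅ := by
        ext z
        simp only [q, Set.mem_preimage, Set.mem_singleton_iff, Set.mem_empty_iff_false, iff_false]
        intro h
        split_ifs at h with h'
        obtain rfl := Option.some.inj h
        exact hiJ (hm1 z h')
      rw [this]; exact isClopen_empty
  · convert hJn using 2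
    ext z
    by_cases h : ∃ j ∈ J, z ∉ F j
    · simp only [q, Set.mem_preimage, if_pos h]
      simpa using h
    · simp only [q, Set.mem_preimage, if_neg h]
      push Not at h
      simpa using h

theorem quasi_not_open {Z : Type u} [TopologicalSpace Z] (x : Z)
    (h : ¬ IsOpen (connectedComponent x)) :
    ¬ IsOpen (⋂ s : { s : Set Z // IsClopen s ∧ x ∈ s }, (s : Set Z)) := by
  intro ho
  set Q := ⋂ s : { s : Set Z // IsClopen s ∧ x ∈ s }, (s : Set Z) with hQ
  have hxQ : x ∈ Q := Set.mem_iInter.2 fun s => s.2.2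
  have hQc : IsClosed Q := isClosed_iInter fun s => s.2.1.1
  have hmin : ∀ s : Set Z, IsClopen s → x ∈ s → Q ⊆ s := fun s hs hx =>
    Set.iInter_subset (fun s : { s : Set Z // IsClopen s ∧ x ∈ s } => (s : Set Z)) ⟨s, hs, hx⟩
  have aux : ∀ u v : Set Z, IsOpen u → IsOpen v → Q ⊆ u ∪ v → Q ∩ (u ∩ v) = ∅ → x ∈ u →
      Q ⊆ u := by
    intro u v hu hv huv hd hx
    have hcl : IsClopen (Q ∩ u) := by
      refine ⟨?_, ho.inter hu⟩
      have : Q ∩ u = Q ∩ vᶜ := by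
        ext z
        constructor
        · rintro ⟨a, b⟩
          exact ⟨a, fun c => (Set.eq_empty_iff_forall_notMem.1 hd z) ⟨a, b, c⟩⟩
        · rintro ⟨a, b⟩
          exact ⟨a, (huv a).resolve_right b⟩
      rw [this]
      exact hQc.inter hv.isClosed_compl
    exact (hmin _ hcl ⟨hxQ, hx⟩).trans Set.inter_subset_right
  have hpre : IsPreconnected Q := by
    rw [isPreconnected_iff_subset_of_disjoint]
    intro u v hu hv huv hd
    rcases huv hxQ with hx | hx
    · exact Or.inl (aux u v hu hv huv hd hx)
    · exact Or.inr (aux v u hv hu (by rwa [Set.union_comm]) (by rwa [Set.inter_comm v u]) hx)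
  apply h
  rw [Set.Subset.antisymm connectedComponent_subset_iInter_isClopen
    (hpre.subset_connectedComponent hxQ)]
  exact ho

/-! ### The comb space -/

/-- The space `X` with a copy of `P` attached at every point of `X` along `p`. -/
@[ext] structure Comb (X P : Type u) (_p : P) : Type u where
  fst : X
  snd : P

instance combTop (X P : Type u) (p : P) [TopologicalSpace X] [TopologicalSpace P] :
    TopologicalSpace (Comb X P p) where
  IsOpen W := IsOpen {x : X | (⟨x, p⟩ : Comb X P _) ∈ W} ∧ ∀ x : X, IsOpen {q : P | (⟨x, q⟩ : Comb X P _) ∈ W}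
  isOpen_univ := ⟨isOpen_univ, fun _ => isOpen_univ⟩
  isOpen_inter := fun _ _ hU hV => ⟨hU.1.inter hV.1, fun x => (hU.2 x).inter (hV.2 x)⟩
  isOpen_sUnion := fun S hS => by
    constructor
    · have : {x : X | (⟨x, p⟩ : Comb X P _) ∈ ⋃₀ S} = ⋃ s ∈ S, {x : X | (⟨x, p⟩ : Comb X P _) ∈ s} := by
        ext x; simp
      rw [this]; exact isOpen_biUnion fun s hs => (hS s hs).1
    · intro x
      have : {q : P | (⟨x, q⟩ : Comb X P _) ∈ ⋃₀ S} = ⋃ s ∈ S, {q : P | (⟨x, q⟩ : Comb X P _) ∈ s} := by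
        ext x; simp
      rw [this]; exact isOpen_biUnion fun s hs => (hS s hs).2 x

theorem comb_isOpen {X P : Type u} {p : P} [TopologicalSpace X] [TopologicalSpace P]
    {W : Set (Comb X P p)} : IsOpen W ↔ IsOpen {x : X | (⟨x, p⟩ : Comb X P _) ∈ W} ∧
      ∀ x : X, IsOpen {q : P | (⟨x, q⟩ : Comb X P _) ∈ W} := Iff.rfl

theorem open_of_notMem {P : Type u} [TopologicalSpace P] {p : P}
    (hp : ∀ z, z ≠ p → IsClopen {z}) (s : Set P) (hs : p ∉ s) : IsOpen s := by
  rw [← Set.biUnion_of_singleton s]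
  exact isOpen_biUnion fun z hz => (hp z (fun e => hs (e ▸ hz))).isOpen

theorem comb_mem_A {𝒜 : SpaceClass.{u}} (hA : IsEpireflectiveClass 𝒜)
    {X P : Type u} [tX : TopologicalSpace X] [T0Space X] [Nontrivial X]
    (hX : 𝒜 X tX) [TopologicalSpace P] (p : P) (hp : ∀ z, z ≠ p → IsClopen {z}) :
    𝒜 (Comb X P p) (combTop X P p) := by
  classical
  obtain ⟨x, y, hxy⟩ := exists_pair_ne X
  obtain ⟨b, c, U, hU, hb, hc⟩ := exists_sep hxy
  have hsing : ∀ (x : X) (q : P), q ≠ p → IsClopen ({(⟨x, q⟩ : Comb X P _)} : Set (Comb X P p)) := by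
    intro x q hq
    constructor
    · rw [← isOpen_compl_iff, comb_isOpen]
      constructor
      · convert isOpen_univ using 1
        ext z
        simp only [Set.mem_ofPred_eq, Set.mem_compl_iff, Set.mem_singleton_iff, Set.mem_univ,
          iff_true]
        exact fun e => hq (Comb.ext_iff.1 e).2.symm
      · intro z
        by_cases hz : z = x
        · subst hz
          convert (hp q hq).1.isOpen_compl using 1
          ext r
          simp only [Set.mem_ofPred_eq, Set.mem_compl_iff, Set.mem_singleton_iff, not_iff_not]
          exact ⟨fun e => (Comb.ext_iff.1 e).2, fun e => by rw [e]⟩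
        · convert isOpen_univ using 1
          ext r
          simp only [Set.mem_ofPred_eq, Set.mem_compl_iff, Set.mem_singleton_iff, Set.mem_univ,
            iff_true]
          exact fun e => hz (Comb.ext_iff.1 e).1
    · rw [comb_isOpen]
      constructor
      · convert isOpen_empty using 1
        ext z
        simp only [Set.mem_ofPred_eq, Set.mem_singleton_iff, Set.mem_empty_iff_false, iff_false]
        exact fun e => hq (Comb.ext_iff.1 e).2.symm
      · intro z
        apply open_of_notMem hp
        simp only [Set.mem_ofPred_eq, Set.mem_singleton_iff]
        exact fun e => hq (Comb.ext_iff.1 e).2.symm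
  have hfst : Continuous (fun z : Comb X P p => z.1) := by
    refine ⟨fun V hV => comb_isOpen.2 ⟨hV, fun x => ?_⟩⟩
    by_cases hx : x ∈ V
    · convert isOpen_univ using 1
      ext r; simp [hx]
    · convert isOpen_empty using 1
      ext r; simp [hx]
  haveI : T0Space (Comb X P p) := by
    refine ⟨fun z w hzw => ?_⟩
    have h1 : z.1 = w.1 := (hzw.map hfst).eq
    by_cases hz : z.2 = p
    · by_cases hw : w.2 = p
      · exact Comb.ext h1 (hz.trans hw.symm)
      · exact (hzw.mem_open_iff (hsing w.1 w.2 hw).2).2 rfl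
    · exact ((hzw.mem_open_iff (hsing z.1 z.2 hz).2).1 rfl).symm
  refine mem_of_maps hA hX (Option {s : Set (Comb X P p) // IsClopen s})
    (fun o z => o.elim z.1 (fun s => if z ∈ s.1 then b else c)) ?_ ?_
  · rintro (_ | s)
    · exact hfst
    · exact ind_continuous b c s.2
  · rintro ⟨x, q⟩ W hW hz
    obtain ⟨V, s, hV, hs, hzV, hzs, hsub⟩ : ∃ (V : Set X) (s : Set (Comb X P p)), IsOpen V ∧
        IsClopen s ∧ x ∈ V ∧ (⟨x, q⟩ : Comb X P _) ∈ s ∧ ∀ w : Comb X P p, w.1 ∈ V → w ∈ s → w ∈ W := by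
      by_cases hq : q = p
      · subst hq
        refine ⟨_, {w | (⟨w.1, q⟩ : Comb X P _) ∈ W → w ∈ W}, hW.1, ?_, hz, fun _ => hz,
          fun w h1 h2 => h2 h1⟩
        constructor
        · rw [← isOpen_compl_iff, comb_isOpen]
          constructor
          · convert isOpen_empty using 1
            ext z; simp
          · intro z
            apply open_of_notMem hp
            simp
        · rw [comb_isOpen]
          constructor
          · convert isOpen_univ using 1
            ext z; simp
          · intro z
            by_cases hzW : (⟨z, q⟩ : Comb X P _) ∈ W
            · convert hW.2 z using 1
              ext r
              exact ⟨fun h => h hzW, fun h _ => h⟩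
            · convert isOpen_univ using 1
              ext r
              exact ⟨fun _ => trivial, fun _ h => absurd h hzW⟩
      · refine ⟨Set.univ, {(⟨x, q⟩ : Comb X P _)}, isOpen_univ, hsing x q hq, trivial, rfl, ?_⟩
        rintro w - hw
        rw [Set.mem_singleton_iff] at hw
        rw [hw]; exact hz
    refine ⟨none, some ⟨s, hs⟩, V, U, hV, hU, hzV, ?_, ?_⟩
    · change (if _ then b else c) ∈ U
      rw [if_pos hzs]; exact hb
    · intro w h1 h2
      refine hsub w h1 ?_
      by_contra hn
      change (if _ then b else c) ∈ U at h2
      rw [if_neg hn] at h2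
      exact hc h2

theorem mem_of_cover {𝒜 ℬ : SpaceClass.{u}} (hB : IsADClass 𝒜 ℬ) (ι : Type u) (Y : ι → Type u)
    (t : ∀ i, TopologicalSpace (Y i)) (hY : ∀ i, ℬ (Y i) (t i)) {Z : Type u}
    (tZ : TopologicalSpace Z) (hZ : 𝒜 Z tZ) (f : ∀ i, Y i → Z) (hs : ∀ z, ∃ i y, f i y = z)
    (ho : ∀ W : Set Z, IsOpen W ↔ ∀ i, IsOpen[t i] (f i ⁻¹' W)) : ℬ Z tZ := by
  refine hB.divisible _ Z (sigmaTop Y t) tZ (fun y => f y.1 y.2) (hB.sums ι Y t hY) hZ ?_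
  refine isQuot_of ⟨?_, ?_⟩
  · intro z
    obtain ⟨i, y, h⟩ := hs z
    exact ⟨⟨i, y⟩, h⟩
  · intro W
    rw [ho]
    unfold sigmaTop
    rw [isOpen_iSup_iff]
    rfl

theorem comb_mem_B {𝒜 ℬ : SpaceClass.{u}} (hA : IsEpireflectiveClass 𝒜) (hB : IsADClass 𝒜 ℬ)
    {X P : Type u} [tX : TopologicalSpace X] [T0Space X] [Nontrivial X]
    (hX : ℬ X tX) [tP : TopologicalSpace P] (hP : ℬ P tP) (p : P)
    (hp : ∀ z, z ≠ p → IsClopen {z}) : ℬ (Comb X P p) (combTop X P p) := by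
  refine mem_of_cover hB (Option X) (fun o => Option.rec X (fun _ => P) o)
    (fun o => Option.rec tX (fun _ => tP) o) ?_ _ (comb_mem_A hA (hB.subset _ _ hX) p hp)
    (fun o => match o with
      | none => fun x => (⟨x, p⟩ : Comb X P _)
      | some x => fun q => (⟨x, q⟩ : Comb X P _)) ?_ ?_
  · rintro (_ | x)
    · exact hX
    · exact hP
  · rintro ⟨x, q⟩
    exact ⟨some x, q, rfl⟩
  · intro W
    rw [comb_isOpen]
    constructor
    · rintro ⟨h1, h2⟩ (_ | x)
      · exact h1
      · exact h2 x
    · intro h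
      exact ⟨h none, fun x => h (some x)⟩

theorem final_step {𝒜 ℬ : SpaceClass.{u}} (hA : IsEpireflectiveClass 𝒜) (hB : IsADClass 𝒜 ℬ)
    (hher : IsHereditary ℬ)
    {X P : Type u} [tX : TopologicalSpace X] [T0Space X] [Nontrivial X]
    (hX : ℬ X tX) [tP : TopologicalSpace P] (hP : ℬ P tP) (p : P)
    (hp : ∀ z, z ≠ p → IsClopen {z}) (hpn : ¬ IsOpen {p}) (a : X) :
    ℬ X (primeFactor tX a) := by
  have hne : ∀ V : Set P, IsOpen V → p ∈ V → ∃ q ∈ V, q ≠ p := by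
    intro V hV hpV
    by_contra hc
    push Not at hc
    apply hpn
    convert hV using 1
    ext r
    exact ⟨fun h => by rw [Set.mem_singleton_iff.1 h]; exact hpV, fun h => hc r h⟩
  let T : Set (Comb X P p) := {z | z.2 ≠ p ∨ z = (⟨a, p⟩ : Comb X P _)}
  have hT : ℬ T instTopologicalSpaceSubtype :=
    hher _ _ T ⟨(⟨a, p⟩ : Comb X P _), Or.inr rfl⟩ (comb_mem_B hA hB hX hP p hp)
  refine hB.divisible T X _ (primeFactor tX a) (fun z => z.1.1) hT
    (primeFactor_mem hA (hB.subset _ _ hX) a) ?_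
  refine isQuot_of ⟨?_, ?_⟩
  · intro x
    obtain ⟨q, -, hq⟩ := hne Set.univ isOpen_univ trivial
    exact ⟨⟨(⟨x, q⟩ : Comb X P _), Or.inl hq⟩, rfl⟩
  · intro W
    constructor
    · intro hW
      obtain ⟨U, hU, hUW, haU⟩ : ∃ U : Set X, IsOpen U ∧ U ⊆ W ∧ (a ∈ W → a ∈ U) := by
        by_cases ha : a ∈ W
        · obtain ⟨U, h1, h2, h3⟩ := mem_nhds_iff.1 (hW ha)
          exact ⟨U, h2, h1, fun _ => h3⟩
        · exact ⟨∅, isOpen_empty, Set.empty_subset _, fun h => absurd h ha⟩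
      refine isOpen_induced_iff.2 ⟨{z | z.1 ∈ U ∨ (z.1 ∈ W ∧ z.2 ≠ p)}, ?_, ?_⟩
      · rw [comb_isOpen]
        constructor
        · convert hU using 1
          ext x; simp
        · intro x
          by_cases hx : x ∈ U
          · convert isOpen_univ using 1
            ext r; simp [hx]
          · apply open_of_notMem hp
            simp [hx]
      · ext ⟨z, hz⟩
        constructor
        · rintro (h | h)
          · exact hUW h
          · exact h.1
        · intro h
          rcases hz with hz | hz
          · exact Or.inr ⟨h, hz⟩
          · subst hz
            exact Or.inl (haU h)
    · intro hW ha
      obtain ⟨O, hO, hOW⟩ := isOpen_induced_iff.1 hW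
      have hmem : ∀ z : Comb X P p, z ∈ T → (z ∈ O ↔ z.1 ∈ W) := fun z hz =>
        Set.ext_iff.1 hOW ⟨z, hz⟩
      refine mem_nhds_iff.2 ⟨_, ?_, hO.1, (hmem (⟨a, p⟩ : Comb X P _) (Or.inr rfl)).2 ha⟩
      intro x hx
      obtain ⟨q, hq, hqp⟩ := hne _ (hO.2 x) hx
      exact (hmem (⟨x, q⟩ : Comb X P _) (Or.inl hqp)).1 hq

/-- A hereditary AD-class (in an epireflective class of T0 spaces
containing a space with two points) containing at least one space that is not
locally connected is closed under prime factors. -/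
theorem statement9 (𝒜 ℬ : SpaceClass.{u})
    (hA : IsEpireflectiveClass 𝒜)
    (hT0 : ∀ (X : Type u) (tX : TopologicalSpace X), 𝒜 X tX → @T0Space X tX)
    (hA2 : ∃ (X : Type u) (tX : TopologicalSpace X), 𝒜 X tX ∧ ∃ x y : X, x ≠ y)
    (hB : IsADClass 𝒜 ℬ)
    (hher : IsHereditary ℬ)
    (hnlc : ∃ (X : Type u) (tX : TopologicalSpace X), ℬ X tX ∧
      ¬ (∀ (x : X) (U : Set X), @IsOpen X tX U → x ∈ U →
          ∃ V : Set X, @IsOpen X tX V ∧ @IsConnected X tX V ∧ x ∈ V ∧ V ⊆ U)) :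
    ∀ (X : Type u) (tX : TopologicalSpace X) (a : X),
      ℬ X tX → ℬ X (primeFactor tX a) := by
  intro X tX a hX
  obtain ⟨M, tM, hM, m1, m2, hm⟩ := hA2
  haveI := hT0 M tM hM
  obtain ⟨b, c, U, hU, hb, hc⟩ := exists_sep hm
  obtain ⟨P, tP, p, hP, hp, hpn⟩ : ∃ (P : Type u) (tP : TopologicalSpace P) (p : P), ℬ P tP ∧
      (∀ z, z ≠ p → IsClopen {z}) ∧ ¬ IsOpen {p} := by
    obtain ⟨N, tN, hN, hlc⟩ := hnlc
    push Not at hlc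
    obtain ⟨x, O, hO, hx, h⟩ := hlc
    have hcc : ¬ IsOpen (connectedComponentIn O x) := fun ho =>
      h _ ho (isConnected_connectedComponentIn_iff.2 hx) (mem_connectedComponentIn hx)
        (connectedComponentIn_subset O x)
    have hcc2 : ¬ IsOpen (connectedComponent (⟨x, hx⟩ : O)) := by
      intro ho
      apply hcc
      rw [connectedComponentIn_eq_image hx]
      exact hO.isOpenMap_subtype_val _ ho
    have hq := quasi_not_open _ hcc2
    obtain ⟨q, h1, h2⟩ := exists_map_of_clopens _ _ (fun s => s.2.1) hq
    exact prime_of_map hA hM b c U hU hb hc hB (hher N tN O ⟨x, hx⟩ hN) q none h1 h2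
  haveI := hT0 X tX (hB.subset _ _ hX)
  rcases subsingleton_or_nontrivial X with hs | hs
  · have : primeFactor tX a = tX := Subsingleton.elim _ _
    rw [this]; exact hX
  · exact final_step hA hB hher hX hP p hp hpn a
end
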